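/- There exists an absolute constant C > 0 such that for every weight w on [0,1) with dyadic A₂ characteristic [w]_{A₂} < ∞ and every measurable φ with ∫_0^1 φ² w dx < ∞, one has w({x ∈ (0,1) : Sφ(x) > 1}) ≤ C [w]_{A₂} log(1 + [w]_{A∞}) ∫_0^1 φ² w dx; consequently the dyadic square function S maps L²(w) to L^{2,∞}(w) with norm at most C' [w]_{A₂}^{1/2} log^{1/2}(1 + [w]_{A∞}). -/

import Mathlib

open MeasureTheory

noncomputable section

/-- The dyadic interval `[k/2^n, (k+1)/2^n)`. -/
def dyadicI (n k : ℕ) : Set ℝ := Set.Ico ((k : ℝ) / 2 ^ n) (((k : ℝ) + 1) / 2 ^ n)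

/-- The average `⟨f⟩_I` of `f` over the dyadic interval `I = (n,k)`. -/
def avg (f : ℝ → ℝ) (n k : ℕ) : ℝ := (2 : ℝ) ^ n * ∫ x in dyadicI n k, f x

/-- The martingale difference `Δ_I f = ⟨f⟩_{I₊} - ⟨f⟩_{I₋}` for `I = (n,k)`. -/
def haarDiff (f : ℝ → ℝ) (n k : ℕ) : ℝ :=
  avg f (n + 1) (2 * k + 1) - avg f (n + 1) (2 * k)

/-- The square of the dyadic square function, `(Sφ(x))² = Σ_{I∈𝒟} (Δ_I φ)² 1_I(x)`,
valued in `ℝ≥0∞`. -/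
def sqFnSq (φ : ℝ → ℝ) (x : ℝ) : ENNReal :=
  ∑' nk : ℕ × ℕ, Set.indicator (dyadicI nk.1 nk.2)
    (fun _ => ENNReal.ofReal ((haarDiff φ nk.1 nk.2) ^ 2)) x

/-- The dyadic maximal function `Mφ(x) = sup_{I∈𝒟, x∈I} ⟨|φ|⟩_I`, valued in `ℝ≥0∞`. -/
def dyMax (φ : ℝ → ℝ) (x : ℝ) : ENNReal :=
  ⨆ (n : ℕ) (k : ℕ), Set.indicator (dyadicI n k)
    (fun _ => ENNReal.ofReal (avg (fun y => |φ y|) n k)) x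

section RealInequalities

lemma two_mul_sqrt_midpoint_le (l a b : ℝ) :
    2 * √(l ^ 2 + ((a + b) / 2) ^ 2) ≤ √(l ^ 2 + a ^ 2) + √(l ^ 2 + b ^ 2) := by
  have ha := Real.sq_sqrt (by positivity : 0 ≤ l ^ 2 + a ^ 2)
  have hb := Real.sq_sqrt (by positivity : 0 ≤ l ^ 2 + b ^ 2)
  have hr := Real.sq_sqrt (by positivity : 0 ≤ l ^ 2 + ((a + b) / 2) ^ 2)
  have hp := Real.sqrt_nonneg (l ^ 2 + a ^ 2)
  have hq := Real.sqrt_nonneg (l ^ 2 + b ^ 2)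
  set p := √(l ^ 2 + a ^ 2)
  set q := √(l ^ 2 + b ^ 2)
  have hpq : l ^ 2 + a * b ≤ p * q := by
    refine le_of_sq_le_sq ?_ (by positivity)
    rw [mul_pow, ha, hb]
    nlinarith [sq_nonneg (l * (a - b))]
  refine le_of_sq_le_sq ?_ (by positivity)
  nlinarith

/-- Quantitative midpoint convexity of `v ↦ √(l² + v²)` on `[-2l, 2l]`. -/
lemma sq_div_add_two_mul_sqrt_midpoint_le {l a b : ℝ} (hl : 0 < l) (ha2 : |a| ≤ 2 * l)
    (hb2 : |b| ≤ 2 * l) :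
    (b - a) ^ 2 / (45 * l) + 2 * √(l ^ 2 + ((a + b) / 2) ^ 2) ≤
      √(l ^ 2 + a ^ 2) + √(l ^ 2 + b ^ 2) := by
  have hmid := two_mul_sqrt_midpoint_le l a b
  have ha := Real.sq_sqrt (by positivity : 0 ≤ l ^ 2 + a ^ 2)
  have hb := Real.sq_sqrt (by positivity : 0 ≤ l ^ 2 + b ^ 2)
  have hr := Real.sq_sqrt (by positivity : 0 ≤ l ^ 2 + ((a + b) / 2) ^ 2)
  have hp := Real.sqrt_nonneg (l ^ 2 + a ^ 2)
  have hq := Real.sqrt_nonneg (l ^ 2 + b ^ 2)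
  have hr0 := Real.sqrt_nonneg (l ^ 2 + ((a + b) / 2) ^ 2)
  have haa : a ^ 2 ≤ 4 * l ^ 2 := by
    have := pow_le_pow_left₀ (abs_nonneg a) ha2 2
    rw [sq_abs] at this; linarith
  have hbb : b ^ 2 ≤ 4 * l ^ 2 := by
    have := pow_le_pow_left₀ (abs_nonneg b) hb2 2
    rw [sq_abs] at this; linarith
  set p := √(l ^ 2 + a ^ 2)
  set q := √(l ^ 2 + b ^ 2)
  set r := √(l ^ 2 + ((a + b) / 2) ^ 2)
  have hp2 : p ≤ 9 / 4 * l := by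
    refine le_of_sq_le_sq ?_ (by positivity); nlinarith
  have hq2 : q ≤ 9 / 4 * l := by
    refine le_of_sq_le_sq ?_ (by positivity); nlinarith
  have hpq : l ^ 2 + a * b ≤ p * q := by
    refine le_of_sq_le_sq ?_ (by positivity)
    rw [mul_pow, ha, hb]
    nlinarith [sq_nonneg (l * (a - b))]
  have hpq_le : p * q ≤ 5 * l ^ 2 := by nlinarith [sq_nonneg (p - q)]
  have hab : a * b ≤ 4 * l ^ 2 := by nlinarith [sq_nonneg (a - b)]
  have hkey : l ^ 2 * (b - a) ^ 2 ≤ l ^ 2 * (10 * (p * q - (l ^ 2 + a * b))) := by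
    have : (p * q - (l ^ 2 + a * b)) * (p * q + (l ^ 2 + a * b)) = l ^ 2 * (b - a) ^ 2 := by
      have : (p * q) ^ 2 = (l ^ 2 + a ^ 2) * (l ^ 2 + b ^ 2) := by rw [mul_pow, ha, hb]
      linear_combination this
    rw [← this]
    nlinarith [mul_nonneg (sub_nonneg.2 hpq)
      (by linarith : 0 ≤ 10 * l ^ 2 - (p * q + (l ^ 2 + a * b)))]
  have hkey' := le_of_mul_le_mul_left hkey (by positivity)
  have hdiff : (b - a) ^ 2 / 5 ≤ (p + q - 2 * r) * (9 * l) := by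
    have h1 : (p + q - 2 * r) * (p + q + 2 * r) = 2 * (p * q - (l ^ 2 + a * b)) := by
      linear_combination ha + hb - 4 * hr
    nlinarith [mul_nonneg (sub_nonneg.2 hmid) (by linarith : 0 ≤ 9 * l - (p + q + 2 * r))]
  have : (b - a) ^ 2 / (45 * l) ≤ p + q - 2 * r := by
    rw [div_le_iff₀ (by positivity)]; nlinarith
  linarith

lemma sq_add_div_add_le {x y s t : ℝ} (hs : 0 < s) (ht : 0 < t) :
    (x + y) ^ 2 / (s + t) ≤ x ^ 2 / s + y ^ 2 / t := by
  rw [div_add_div _ _ hs.ne' ht.ne', div_le_div_iff₀ (by positivity) (by positivity)]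
  nlinarith [sq_nonneg (x * t - y * s), mul_pos hs ht]

/-- The convex minorant `(u + √(l² + v²) - l) / 2` of `u` on the cone `|v| ≤ u`. -/
def coneMinorant (l u v : ℝ) : ℝ := (u + (√(l ^ 2 + v ^ 2) - l)) / 2

lemma sqrt_sub_nonneg (l v : ℝ) : 0 ≤ √(l ^ 2 + v ^ 2) - l :=
  sub_nonneg.2 (Real.le_sqrt_of_sq_le (by nlinarith [sq_nonneg v]))

lemma sqrt_sub_le_abs {l : ℝ} (hl : 0 < l) (v : ℝ) : √(l ^ 2 + v ^ 2) - l ≤ |v| := by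
  rw [sub_le_iff_le_add, Real.sqrt_le_left (by positivity)]
  nlinarith [abs_nonneg v, sq_abs v, mul_nonneg (abs_nonneg v) hl.le]

lemma half_le_coneMinorant (l u v : ℝ) : u / 2 ≤ coneMinorant l u v := by
  have := sqrt_sub_nonneg l v
  unfold coneMinorant; linarith

lemma coneMinorant_le {l u v : ℝ} (hl : 0 < l) (h : |v| ≤ u) : coneMinorant l u v ≤ u := by
  have := sqrt_sub_le_abs hl v
  unfold coneMinorant; linarith

lemma coneMinorant_sq_div_midpoint_le {l u₁ u₂ v₁ v₂ s₁ s₂ : ℝ} (hl : 0 < l)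
    (h₁ : |v₁| ≤ u₁) (h₂ : |v₂| ≤ u₂) (hs₁ : 0 < s₁) (hs₂ : 0 < s₂) :
    (if l / 2 < (u₁ + u₂) / 2 ∧ (u₁ + u₂) / 2 ≤ l then (v₂ - v₁) ^ 2 else 0) /
        (360 * ((s₁ + s₂) / 2)) +
      coneMinorant l ((u₁ + u₂) / 2) ((v₁ + v₂) / 2) ^ 2 / ((s₁ + s₂) / 2) ≤
      (coneMinorant l u₁ v₁ ^ 2 / s₁ + coneMinorant l u₂ v₂ ^ 2 / s₂) / 2 := by
  have hs := sq_add_div_add_le (x := coneMinorant l u₁ v₁) (y := coneMinorant l u₂ v₂) hs₁ hs₂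
  have hu₁ : 0 ≤ u₁ := (abs_nonneg _).trans h₁
  have hu₂ : 0 ≤ u₂ := (abs_nonneg _).trans h₂
  have hlow := half_le_coneMinorant l ((u₁ + u₂) / 2) ((v₁ + v₂) / 2)
  set c := coneMinorant l ((u₁ + u₂) / 2) ((v₁ + v₂) / 2) with hc
  set c₁ := coneMinorant l u₁ v₁ with hc₁
  set c₂ := coneMinorant l u₂ v₂ with hc₂
  have key : (if l / 2 < (u₁ + u₂) / 2 ∧ (u₁ + u₂) / 2 ≤ l then (v₂ - v₁) ^ 2 else 0) / 360 +
      c ^ 2 ≤ ((c₁ + c₂) / 2) ^ 2 := by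
    split_ifs with h
    · have hg := sq_div_add_two_mul_sqrt_midpoint_le (a := v₁) (b := v₂) hl (by linarith [h.2])
        (by linarith [h.2])
      have h4 : (v₂ - v₁) ^ 2 / (45 * l) / 4 + c ≤ (c₁ + c₂) / 2 := by
        rw [hc, hc₁, hc₂]; unfold coneMinorant; linarith
      have h5 : l / 4 ≤ c := by linarith [h.1]
      have h6 : 0 ≤ (v₂ - v₁) ^ 2 / (45 * l) / 4 := by positivity
      have h7 : (v₂ - v₁) ^ 2 / 360 = 2 * (l / 4) * ((v₂ - v₁) ^ 2 / (45 * l) / 4) := by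
        field_simp; ring
      rw [h7]
      nlinarith [mul_le_mul_of_nonneg_right h5 h6]
    · have hg := two_mul_sqrt_midpoint_le l v₁ v₂
      have h4 : c ≤ (c₁ + c₂) / 2 := by
        rw [hc, hc₁, hc₂]; unfold coneMinorant; linarith
      nlinarith
  calc _ = ((if l / 2 < (u₁ + u₂) / 2 ∧ (u₁ + u₂) / 2 ≤ l then (v₂ - v₁) ^ 2 else 0) / 360 +
      c ^ 2) / ((s₁ + s₂) / 2) := by field_simp
    _ ≤ ((c₁ + c₂) / 2) ^ 2 / ((s₁ + s₂) / 2) := by gcongr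
    _ = (c₁ + c₂) ^ 2 / (s₁ + s₂) / 2 := by field_simp
    _ ≤ _ := by linarith

end RealInequalities

section TreeSums

variable {M : Type*} [AddCommMonoid M]

/-- The sum of `a` over the descendants of the node `(n, k)` of the dyadic tree, of generation
less than `N` relative to `(n, k)`. -/
def treeSum (a : ℕ → ℕ → M) : ℕ → ℕ → ℕ → M
  | 0, _, _ => 0
  | N + 1, n, k => a n k + (treeSum a N (n + 1) (2 * k) + treeSum a N (n + 1) (2 * k + 1))

lemma child_lt {n k : ℕ} (hk : k < 2 ^ n) : 2 * k < 2 ^ (n + 1) ∧ 2 * k + 1 < 2 ^ (n + 1) := by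
  rw [pow_succ]; omega

lemma treeSum_nonneg {a : ℕ → ℕ → ℝ} (h : ∀ n k, k < 2 ^ n → 0 ≤ a n k) (N : ℕ) :
    ∀ n k, k < 2 ^ n → 0 ≤ treeSum a N n k := by
  induction N with
  | zero => intro n k _; exact le_rfl
  | succ N ih =>
    intro n k hk
    exact add_nonneg (h n k hk)
      (add_nonneg (ih _ _ (child_lt hk).1) (ih _ _ (child_lt hk).2))

/-- Telescoping of a potential `g` along the dyadic tree. -/
lemma treeSum_add_le {a g h : ℕ → ℕ → ℝ}
    (hg : ∀ n k, k < 2 ^ n → a n k + g n k ≤ g (n + 1) (2 * k) + g (n + 1) (2 * k + 1))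
    (hgh : ∀ n k, k < 2 ^ n → g n k ≤ h n k)
    (hh : ∀ n k, k < 2 ^ n → h n k = h (n + 1) (2 * k) + h (n + 1) (2 * k + 1)) (N : ℕ) :
    ∀ n k, k < 2 ^ n → treeSum a N n k + g n k ≤ h n k := by
  induction N with
  | zero => intro n k hk; simpa [treeSum] using hgh n k hk
  | succ N ih =>
    intro n k hk
    have h1 := ih _ _ (child_lt hk).1
    have h2 := ih _ _ (child_lt hk).2
    have h3 := hg n k hk
    have h4 := hh n k hk
    simp only [treeSum]
    linarith

end TreeSums

section DyadicIntervals

lemma measurableSet_dyadicI (n k : ℕ) : MeasurableSet (dyadicI n k) := measurableSet_Ico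

lemma mem_dyadicI_iff {n k : ℕ} {x : ℝ} :
    x ∈ dyadicI n k ↔ 0 ≤ x ∧ ⌊(2 : ℝ) ^ n * x⌋₊ = k := by
  have h2 : (0 : ℝ) < 2 ^ n := by positivity
  rw [dyadicI, Set.mem_Ico, div_le_iff₀ h2, lt_div_iff₀ h2, mul_comm x]
  constructor
  · rintro ⟨h, h'⟩
    have hx : 0 ≤ 2 ^ n * x := (Nat.cast_nonneg k).trans h
    exact ⟨nonneg_of_mul_nonneg_right hx h2, (Nat.floor_eq_iff hx).2 ⟨h, h'⟩⟩
  · rintro ⟨hx, h⟩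
    exact (Nat.floor_eq_iff (by positivity)).1 h

lemma floor_lt_two_pow {x : ℝ} (hx : 0 ≤ x) (hx1 : x < 1) (n : ℕ) :
    ⌊(2 : ℝ) ^ n * x⌋₊ < 2 ^ n := by
  rw [Nat.floor_lt (by positivity)]
  push_cast
  exact mul_lt_of_lt_one_right (by positivity) hx1

lemma dyadicI_zero_zero : dyadicI 0 0 = Set.Ico (0 : ℝ) 1 := by simp [dyadicI]

lemma dyadicI_subset_Ico {n k : ℕ} (hk : k < 2 ^ n) : dyadicI n k ⊆ Set.Ico (0 : ℝ) 1 := by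
  apply Set.Ico_subset_Ico (by positivity)
  rw [div_le_one (by positivity)]
  exact_mod_cast hk

lemma dyadicI_eq_union (n k : ℕ) :
    dyadicI n k = dyadicI (n + 1) (2 * k) ∪ dyadicI (n + 1) (2 * k + 1) := by
  have h1 : (k : ℝ) / 2 ^ n = ((2 * k : ℕ) : ℝ) / 2 ^ (n + 1) := by
    rw [pow_succ]; push_cast; field_simp
  have h2 : ((k : ℝ) + 1) / 2 ^ n = (((2 * k + 1 : ℕ) : ℝ) + 1) / 2 ^ (n + 1) := by
    rw [pow_succ]; push_cast; field_simp; ring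
  unfold dyadicI
  rw [h1, h2, show ((2 * k + 1 : ℕ) : ℝ) = ((2 * k : ℕ) : ℝ) + 1 by push_cast; ring]
  symm
  apply Set.Ico_union_Ico_eq_Ico <;> · gcongr; linarith

lemma disjoint_dyadicI_children (n k : ℕ) :
    Disjoint (dyadicI (n + 1) (2 * k)) (dyadicI (n + 1) (2 * k + 1)) := by
  rw [Set.disjoint_left]
  intro x hx hx'
  have := (mem_dyadicI_iff.1 hx).2.symm.trans (mem_dyadicI_iff.1 hx').2
  omega

lemma left_subset_dyadicI (n k : ℕ) : dyadicI (n + 1) (2 * k) ⊆ dyadicI n k := by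
  rw [dyadicI_eq_union n k]; exact Set.subset_union_left

lemma right_subset_dyadicI (n k : ℕ) : dyadicI (n + 1) (2 * k + 1) ⊆ dyadicI n k := by
  rw [dyadicI_eq_union n k]; exact Set.subset_union_right

lemma volume_dyadicI (n k : ℕ) : volume (dyadicI n k) = ENNReal.ofReal (2 ^ n)⁻¹ := by
  rw [dyadicI, Real.volume_Ico]
  congr 1; field_simp; ring

lemma setLIntegral_dyadicI_split (μ : Measure ℝ) (f : ℝ → ENNReal) (n k : ℕ) :
    ∫⁻ x in dyadicI n k, f x ∂μ =
      ∫⁻ x in dyadicI (n + 1) (2 * k), f x ∂μ + ∫⁻ x in dyadicI (n + 1) (2 * k + 1), f x ∂μ := by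
  rw [dyadicI_eq_union n k,
    lintegral_union (measurableSet_dyadicI _ _) (disjoint_dyadicI_children n k)]

variable {f : ℝ → ℝ}

lemma setIntegral_dyadicI_split (hf : IntegrableOn f (Set.Ico 0 1)) {n k : ℕ} (hk : k < 2 ^ n) :
    ∫ x in dyadicI n k, f x =
      (∫ x in dyadicI (n + 1) (2 * k), f x) + ∫ x in dyadicI (n + 1) (2 * k + 1), f x := by
  rw [dyadicI_eq_union n k, setIntegral_union (disjoint_dyadicI_children n k)
    (measurableSet_dyadicI _ _) (hf.mono_set (dyadicI_subset_Ico (child_lt hk).1))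
    (hf.mono_set (dyadicI_subset_Ico (child_lt hk).2))]

lemma avg_split (hf : IntegrableOn f (Set.Ico 0 1)) {n k : ℕ} (hk : k < 2 ^ n) :
    avg f n k = (avg f (n + 1) (2 * k) + avg f (n + 1) (2 * k + 1)) / 2 := by
  rw [avg, avg, avg, setIntegral_dyadicI_split hf hk, pow_succ]; ring

lemma abs_avg_le (f : ℝ → ℝ) (n k : ℕ) : |avg f n k| ≤ avg (fun x => |f x|) n k := by
  rw [avg, avg, abs_mul, abs_of_pos (by positivity : (0 : ℝ) < 2 ^ n)]
  gcongr
  exact abs_integral_le_integral_abs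

lemma setIntegral_pos_of_pos (hf : IntegrableOn f (Set.Ico 0 1))
    (hpos : ∀ x ∈ Set.Ico (0 : ℝ) 1, 0 < f x) {n k : ℕ} (hk : k < 2 ^ n) :
    0 < ∫ x in dyadicI n k, f x := by
  have hsub := dyadicI_subset_Ico hk
  rw [setIntegral_pos_iff_support_of_nonneg_ae _ (hf.mono_set hsub)]
  · have : Function.support f ∩ dyadicI n k = dyadicI n k :=
      Set.inter_eq_right.2 fun x hx => (hpos x (hsub hx)).ne'
    rw [this, volume_dyadicI, ENNReal.ofReal_pos]
    positivity
  · filter_upwards [ae_restrict_mem (measurableSet_dyadicI n k)] with x hx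
    exact (hpos x (hsub hx)).le

lemma avg_pos_of_pos (hf : IntegrableOn f (Set.Ico 0 1))
    (hpos : ∀ x ∈ Set.Ico (0 : ℝ) 1, 0 < f x) {n k : ℕ} (hk : k < 2 ^ n) : 0 < avg f n k :=
  mul_pos (by positivity) (setIntegral_pos_of_pos hf hpos hk)

variable {w φ : ℝ → ℝ}

lemma integrableOn_of_sq_mul_weight (hwpos : ∀ x ∈ Set.Ico (0 : ℝ) 1, 0 < w x)
    (hσ : IntegrableOn (fun x => (w x)⁻¹) (Set.Ico (0 : ℝ) 1)) (hφ : Measurable φ)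
    (hφw : IntegrableOn (fun x => φ x ^ 2 * w x) (Set.Ico (0 : ℝ) 1)) :
    IntegrableOn φ (Set.Ico (0 : ℝ) 1) := by
  refine Integrable.mono' (hφw.add hσ) hφ.aestronglyMeasurable ?_
  filter_upwards [ae_restrict_mem measurableSet_Ico] with x hx
  have h := hwpos x hx
  have h1 : (w x) * (w x)⁻¹ = 1 := mul_inv_cancel₀ h.ne'
  have h2 : 0 < (w x)⁻¹ := inv_pos.2 h
  have h3 : 0 ≤ (w x)⁻¹ * (|φ x| * w x - 1) ^ 2 := by positivity
  have h4 : (w x)⁻¹ * (|φ x| * w x - 1) ^ 2 = φ x ^ 2 * w x - 2 * |φ x| + (w x)⁻¹ := by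
    rw [← sq_abs (φ x)]
    linear_combination (|φ x| ^ 2 * w x - 2 * |φ x|) * h1
  simp only [Real.norm_eq_abs, Pi.add_apply]
  linarith [abs_nonneg (φ x)]

/-- The Cauchy–Schwarz inequality `(∫_I |φ|)² ≤ (∫_I φ² w) (∫_I w⁻¹)` on a dyadic interval. -/
lemma avg_abs_sq_div_le (hwpos : ∀ x ∈ Set.Ico (0 : ℝ) 1, 0 < w x)
    (hσ : IntegrableOn (fun x => (w x)⁻¹) (Set.Ico (0 : ℝ) 1))
    (hφ : IntegrableOn φ (Set.Ico (0 : ℝ) 1))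
    (hφw : IntegrableOn (fun x => φ x ^ 2 * w x) (Set.Ico (0 : ℝ) 1)) {n k : ℕ} (hk : k < 2 ^ n) :
    (2 ^ n)⁻¹ * (avg (fun x => |φ x|) n k ^ 2 / avg (fun x => (w x)⁻¹) n k) ≤
      ∫ x in dyadicI n k, φ x ^ 2 * w x := by
  have hsub := dyadicI_subset_Ico hk
  have hσpos := setIntegral_pos_of_pos hσ (fun x hx => inv_pos.2 (hwpos x hx)) hk
  set U := ∫ x in dyadicI n k, |φ x| with hU
  set σ := ∫ x in dyadicI n k, (w x)⁻¹ with hσdef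
  have key : 2 * (U / σ) * U ≤ (∫ x in dyadicI n k, φ x ^ 2 * w x) + (U / σ) ^ 2 * σ := by
    rw [hU, hσdef, ← integral_const_mul, ← integral_const_mul, ← integral_add
      (hφw.mono_set hsub) ((hσ.mono_set hsub).const_mul _), ← hU, ← hσdef]
    apply setIntegral_mono_on ((hφ.mono_set hsub).abs.const_mul _)
      ((hφw.mono_set hsub).add ((hσ.mono_set hsub).const_mul _)) (measurableSet_dyadicI n k)
    intro x hx
    have h := hwpos x (hsub hx)
    set t := U / σ
    have h1 : (w x) * (w x)⁻¹ = 1 := mul_inv_cancel₀ h.ne'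
    have h2 : 0 < (w x)⁻¹ := inv_pos.2 h
    have h3 : 0 ≤ (w x)⁻¹ * (|φ x| * w x - t) ^ 2 := by positivity
    have h4 : (w x)⁻¹ * (|φ x| * w x - t) ^ 2 =
        φ x ^ 2 * w x - 2 * t * |φ x| + t ^ 2 * (w x)⁻¹ := by
      rw [← sq_abs (φ x)]
      linear_combination (|φ x| ^ 2 * w x - 2 * t * |φ x|) * h1
    simp only [Pi.add_apply]
    linarith
  have h5 : (2 ^ n)⁻¹ * (avg (fun x => |φ x|) n k ^ 2 / avg (fun x => (w x)⁻¹) n k) = U ^ 2 / σ := by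
    simp only [avg, ← hU, ← hσdef]; field_simp
  have h6 : 2 * (U / σ) * U = 2 * (U ^ 2 / σ) := by ring
  have h7 : (U / σ) ^ 2 * σ = U ^ 2 / σ := by field_simp
  rw [h5]; linarith

end DyadicIntervals

section LevelSums

/-- The coefficients `(Δ_I φ)²` restricted to the intervals with `l / 2 < ⟨|φ|⟩_I ≤ l`. -/
def levelCoeff (φ : ℝ → ℝ) (l : ℝ) (n k : ℕ) : ℝ :=
  if l / 2 < avg (fun x => |φ x|) n k ∧ avg (fun x => |φ x|) n k ≤ l then haarDiff φ n k ^ 2 else 0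

lemma levelCoeff_nonneg (φ : ℝ → ℝ) (l : ℝ) (n k : ℕ) : 0 ≤ levelCoeff φ l n k := by
  unfold levelCoeff; split_ifs <;> positivity

variable {w φ : ℝ → ℝ} {l : ℝ}

/-- Energy estimate on one level, linear in the `A₂` characteristic. -/
lemma treeSum_levelCoeff_mul_weight_le (hwpos : ∀ x ∈ Set.Ico (0 : ℝ) 1, 0 < w x)
    (hσ : IntegrableOn (fun x => (w x)⁻¹) (Set.Ico (0 : ℝ) 1))
    {Q : ℝ} (hQ : 0 < Q)
    (hA₂ : ∀ n k : ℕ, k < 2 ^ n → avg w n k * avg (fun x => (w x)⁻¹) n k ≤ Q)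
    (hφ : IntegrableOn φ (Set.Ico (0 : ℝ) 1))
    (hφw : IntegrableOn (fun x => φ x ^ 2 * w x) (Set.Ico (0 : ℝ) 1)) (hl : 0 < l)
    (N n k : ℕ) (hk : k < 2 ^ n) :
    treeSum (fun n k => levelCoeff φ l n k * ∫ x in dyadicI n k, w x) N n k ≤
      360 * Q * ∫ x in dyadicI n k, φ x ^ 2 * w x := by
  have hspos : ∀ n k, k < 2 ^ n → 0 < avg (fun x => (w x)⁻¹) n k := fun n k hk =>
    avg_pos_of_pos hσ (fun x hx => inv_pos.2 (hwpos x hx)) hk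
  have hφa : IntegrableOn (fun x => |φ x|) (Set.Ico (0 : ℝ) 1) := hφ.abs
  set u := avg (fun x => |φ x|) with hu
  set v := avg φ with hv
  set s := avg (fun x => (w x)⁻¹) with hs
  have hvu : ∀ n k, |v n k| ≤ u n k := abs_avg_le φ
  have main := treeSum_add_le (a := fun n k => levelCoeff φ l n k * ∫ x in dyadicI n k, w x)
    (g := fun n k => 360 * Q * ((2 ^ n)⁻¹ * (coneMinorant l (u n k) (v n k) ^ 2 / s n k)))
    (h := fun n k => 360 * Q * ∫ x in dyadicI n k, φ x ^ 2 * w x) ?_ ?_ ?_ N n k hk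
  · have : 0 ≤ 360 * Q * ((2 ^ n)⁻¹ * (coneMinorant l (u n k) (v n k) ^ 2 / s n k)) := by
      have := hspos n k hk
      positivity
    linarith
  · intro n k hk
    obtain ⟨hk1, hk2⟩ := child_lt hk
    have hgap := coneMinorant_sq_div_midpoint_le hl (hvu (n + 1) (2 * k))
      (hvu (n + 1) (2 * k + 1)) (hspos _ _ hk1) (hspos _ _ hk2)
    rw [hu, hv, hs, ← avg_split hφa hk, ← avg_split hφ hk, ← avg_split hσ hk, ← hu, ← hv,
      ← hs] at hgap
    change levelCoeff φ l n k / _ + _ ≤ _ at hgap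
    have hsp := hspos n k hk
    have hc := levelCoeff_nonneg φ l n k
    have hW : levelCoeff φ l n k * ∫ x in dyadicI n k, w x ≤
        360 * Q * ((2 ^ n)⁻¹ * (levelCoeff φ l n k / (360 * s n k))) := by
      have h1 : avg w n k ≤ Q / s n k := (le_div_iff₀ hsp).2 (hA₂ n k hk)
      have h2 : ∫ x in dyadicI n k, w x = (2 ^ n)⁻¹ * avg w n k := by unfold avg; field_simp
      rw [h2]
      calc levelCoeff φ l n k * ((2 ^ n)⁻¹ * avg w n k)
          ≤ levelCoeff φ l n k * ((2 ^ n)⁻¹ * (Q / s n k)) := by gcongr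
        _ = _ := by field_simp
    have h3 : (0 : ℝ) ≤ 360 * Q * (2 ^ n)⁻¹ := by positivity
    have h4 := mul_le_mul_of_nonneg_left hgap h3
    have h5 : ((2 : ℝ) ^ (n + 1))⁻¹ = (2 ^ n)⁻¹ / 2 := by rw [pow_succ]; field_simp
    rw [h5]
    linarith
  · intro n k hk
    have h1 := avg_abs_sq_div_le hwpos hσ hφ hφw hk
    have hsp := hspos n k hk
    have h2 : coneMinorant l (u n k) (v n k) ^ 2 ≤ u n k ^ 2 := by
      have h3 := half_le_coneMinorant l (u n k) (v n k)
      have h4 := (abs_nonneg _).trans (hvu n k)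
      exact pow_le_pow_left₀ (by linarith) (coneMinorant_le hl (hvu n k)) 2
    refine mul_le_mul_of_nonneg_left (le_trans ?_ h1) (by positivity)
    gcongr
  · intro n k hk
    rw [setIntegral_dyadicI_split hφw hk, mul_add]

/-- The coefficients of one level form a Carleson sequence. -/
lemma treeSum_levelCoeff_le (hφ : IntegrableOn φ (Set.Ico (0 : ℝ) 1)) (hl : 0 < l) (N : ℕ) :
    ∀ n k, k < 2 ^ n → treeSum (fun n k => levelCoeff φ l n k * (2 ^ n)⁻¹) N n k ≤
      90 * l ^ 2 * (2 ^ n)⁻¹ := by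
  have hφa : IntegrableOn (fun x => |φ x|) (Set.Ico (0 : ℝ) 1) := hφ.abs
  set u := avg (fun x => |φ x|) with hu
  set v := avg φ with hv
  have hvu : ∀ n k, |v n k| ≤ u n k := abs_avg_le φ
  have main := fun N => treeSum_add_le (a := fun n k => levelCoeff φ l n k * (2 ^ n)⁻¹)
    (g := fun n k => 90 * l * ((2 ^ n)⁻¹ * (√(l ^ 2 + v n k ^ 2) - l)))
    (h := fun n k => 90 * l * ∫ x in dyadicI n k, |φ x|) ?_ ?_ ?_ N
  · induction N with
    | zero => intro n k _; simp only [treeSum]; positivity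
    | succ N ih =>
      intro n k hk
      by_cases h : u n k ≤ l
      · have h1 := main (N + 1) n k hk
        have h2 := sqrt_sub_nonneg l (v n k)
        have h3 : 0 ≤ 90 * l * ((2 ^ n)⁻¹ * (√(l ^ 2 + v n k ^ 2) - l)) := by positivity
        have h4 : ∫ x in dyadicI n k, |φ x| = (2 ^ n)⁻¹ * u n k := by rw [hu]; unfold avg; field_simp
        have h5 : 90 * l * ((2 ^ n)⁻¹ * u n k) ≤ 90 * l * ((2 ^ n)⁻¹ * l) := by gcongr
        rw [h4] at h1
        linarith
      · have h1 := ih _ _ (child_lt hk).1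
        have h2 := ih _ _ (child_lt hk).2
        have h3 : levelCoeff φ l n k = 0 := if_neg fun h' => h h'.2
        have h5 : ((2 : ℝ) ^ (n + 1))⁻¹ = (2 ^ n)⁻¹ / 2 := by rw [pow_succ]; field_simp
        rw [h5] at h1 h2
        simp only [treeSum, h3]
        linarith
  · intro n k hk
    have hv2 : v n k = (v (n + 1) (2 * k) + v (n + 1) (2 * k + 1)) / 2 := avg_split hφ hk
    have hu2 : u n k = (u (n + 1) (2 * k) + u (n + 1) (2 * k + 1)) / 2 := avg_split hφa hk
    have hgap : levelCoeff φ l n k / (45 * l) + 2 * √(l ^ 2 + v n k ^ 2) ≤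
        √(l ^ 2 + v (n + 1) (2 * k) ^ 2) + √(l ^ 2 + v (n + 1) (2 * k + 1) ^ 2) := by
      unfold levelCoeff
      rw [hv2]
      have h1 := hvu (n + 1) (2 * k)
      have h2 := hvu (n + 1) (2 * k + 1)
      have h3 := abs_nonneg (v (n + 1) (2 * k))
      have h4 := abs_nonneg (v (n + 1) (2 * k + 1))
      split_ifs with h
      · exact sq_div_add_two_mul_sqrt_midpoint_le hl (by linarith [h.2]) (by linarith [h.2])
      · simpa using two_mul_sqrt_midpoint_le l (v (n + 1) (2 * k)) (v (n + 1) (2 * k + 1))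
    have h3 : (0 : ℝ) ≤ 45 * l * (2 ^ n)⁻¹ := by positivity
    have h4 := mul_le_mul_of_nonneg_left hgap h3
    have h5 : ((2 : ℝ) ^ (n + 1))⁻¹ = (2 ^ n)⁻¹ / 2 := by rw [pow_succ]; field_simp
    have h6 : 45 * l * (2 ^ n)⁻¹ * (levelCoeff φ l n k / (45 * l)) =
        levelCoeff φ l n k * (2 ^ n)⁻¹ := by field_simp
    rw [mul_add, h6] at h4
    rw [h5]
    linarith
  · intro n k hk
    have h4 : ∫ x in dyadicI n k, |φ x| = (2 ^ n)⁻¹ * u n k := by rw [hu]; unfold avg; field_simp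
    simp only [h4]
    gcongr
    exact (sqrt_sub_le_abs hl _).trans (hvu n k)
  · intro n k hk
    rw [setIntegral_dyadicI_split hφa hk, mul_add]

/-- The Carleson embedding theorem in `L¹`. -/
lemma ofReal_treeSum_mul_le_lintegral {α b : ℕ → ℕ → ℝ} (hα : ∀ n k, k < 2 ^ n → 0 ≤ α n k)
    {D : ℝ} (hαD : ∀ N n k, k < 2 ^ n → treeSum α N n k ≤ D * (2 ^ n)⁻¹)
    (G : ℝ → ENNReal) (J : Set ℝ)
    (hG : ∀ n k x, dyadicI n k ⊆ J → x ∈ dyadicI n k → ENNReal.ofReal (b n k) ≤ G x) (N : ℕ) :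
    ∀ n k, k < 2 ^ n → dyadicI n k ⊆ J → ∀ m : ℝ, 0 ≤ m →
      (∀ x ∈ dyadicI n k, ENNReal.ofReal m ≤ G x) →
      ENNReal.ofReal (treeSum (fun n k => α n k * b n k) N n k +
        (D * (2 ^ n)⁻¹ - treeSum α N n k) * m) ≤ ENNReal.ofReal D * ∫⁻ x in dyadicI n k, G x := by
  have hD : 0 ≤ D := by simpa [treeSum] using hαD 0 0 0 (by norm_num)
  induction N with
  | zero =>
    intro n k hk _ m hm hmG
    simp only [treeSum, zero_add, sub_zero]
    rw [mul_assoc, ENNReal.ofReal_mul hD]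
    gcongr
    calc _ = ∫⁻ x in dyadicI n k, ENNReal.ofReal m := by
          rw [setLIntegral_const, volume_dyadicI, mul_comm, ENNReal.ofReal_mul hm]
      _ ≤ _ := setLIntegral_mono' (measurableSet_dyadicI n k) hmG
  | succ N ih =>
    intro n k hk hJ m hm hmG
    obtain ⟨hk1, hk2⟩ := child_lt hk
    have hJ1 := left_subset_dyadicI n k
    have hJ2 := right_subset_dyadicI n k
    have hm' : 0 ≤ max m (b n k) := hm.trans (le_max_left _ _)
    have hmG' : ∀ x ∈ dyadicI n k, ENNReal.ofReal (max m (b n k)) ≤ G x := by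
      intro x hx
      rcases max_choice m (b n k) with h | h <;> rw [h]
      · exact hmG x hx
      · exact hG n k x hJ hx
    have h1 := ih _ _ hk1 (hJ1.trans hJ) _ hm' fun x hx => hmG' x (hJ1 hx)
    have h2 := ih _ _ hk2 (hJ2.trans hJ) _ hm' fun x hx => hmG' x (hJ2 hx)
    rw [setLIntegral_dyadicI_split, mul_add]
    refine le_trans ?_ ((ENNReal.ofReal_add_le).trans (add_le_add h1 h2))
    apply ENNReal.ofReal_le_ofReal
    have h3 := hαD (N + 1) n k hk
    have h5 : ((2 : ℝ) ^ (n + 1))⁻¹ = (2 ^ n)⁻¹ / 2 := by rw [pow_succ]; field_simp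
    have h6 : (D * (2 ^ n)⁻¹ - treeSum α (N + 1) n k) * m ≤
        (D * (2 ^ n)⁻¹ - treeSum α (N + 1) n k) * max m (b n k) :=
      mul_le_mul_of_nonneg_left (le_max_left _ _) (by linarith)
    have h7 : α n k * b n k ≤ α n k * max m (b n k) :=
      mul_le_mul_of_nonneg_left (le_max_right _ _) (hα n k hk)
    simp only [treeSum] at h6 ⊢
    rw [h5]
    linarith

/-- Weighted Carleson estimate on one level, linear in the Fujii–Wilson characteristic. -/
lemma treeSum_levelCoeff_mul_weight_le_mul (hwpos : ∀ x ∈ Set.Ico (0 : ℝ) 1, 0 < w x)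
    {P : ℝ} (hP : 0 ≤ P)
    (hFW : ∀ n k : ℕ, k < 2 ^ n →
      ∫⁻ x in dyadicI n k, dyMax (Set.indicator (dyadicI n k) w) x
        ≤ ENNReal.ofReal (P * ∫ x in dyadicI n k, w x))
    (hφ : IntegrableOn φ (Set.Ico (0 : ℝ) 1)) (hl : 0 < l) (N n k : ℕ) (hk : k < 2 ^ n) :
    treeSum (fun n k => levelCoeff φ l n k * ∫ x in dyadicI n k, w x) N n k ≤
      90 * l ^ 2 * P * ∫ x in dyadicI n k, w x := by
  have hsub := dyadicI_subset_Ico hk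
  have hW : 0 ≤ ∫ x in dyadicI n k, w x :=
    setIntegral_nonneg (measurableSet_dyadicI n k) fun x hx => (hwpos x (hsub hx)).le
  have h := ofReal_treeSum_mul_le_lintegral (α := fun n k => levelCoeff φ l n k * (2 ^ n)⁻¹)
    (b := avg w) (D := 90 * l ^ 2)
    (fun n k _ => mul_nonneg (levelCoeff_nonneg φ l n k) (by positivity))
    (treeSum_levelCoeff_le hφ hl) (dyMax (Set.indicator (dyadicI n k) w)) (dyadicI n k) ?_
    N n k hk subset_rfl 0 le_rfl (by simp)
  · have h2 := h.trans (mul_le_mul_right (hFW n k hk) _)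
    rw [← ENNReal.ofReal_mul (by positivity), ENNReal.ofReal_le_ofReal_iff (by positivity)] at h2
    have h3 : (fun n k => levelCoeff φ l n k * (2 ^ n)⁻¹ * avg w n k) =
        fun n k => levelCoeff φ l n k * ∫ x in dyadicI n k, w x := by
      funext n k; unfold avg; field_simp
    rw [h3] at h2
    linarith
  · intro m j x hI hx
    have h1 : avg (fun y => |Set.indicator (dyadicI n k) w y|) m j = avg w m j := by
      unfold avg
      congr 1
      apply setIntegral_congr_fun (measurableSet_dyadicI m j)
      intro y hy
      simp only [Set.indicator_of_mem (hI hy)]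
      exact abs_of_pos (hwpos y (hsub (hI hy)))
    unfold dyMax
    refine le_iSup_of_le m (le_iSup_of_le j ?_)
    rw [Set.indicator_of_mem hx, h1]

end LevelSums

section BranchSums

/-- The sum of `β` over the dyadic intervals containing `x` of generations `n, …, n + N - 1`. -/
def branchSum (β : ℕ → ℕ → ENNReal) (N n : ℕ) (x : ℝ) : ENNReal :=
  ∑ i ∈ Finset.range N, β (n + i) ⌊(2 : ℝ) ^ (n + i) * x⌋₊

lemma measurable_branchTerm (β : ℕ → ℕ → ENNReal) (n : ℕ) :
    Measurable fun x : ℝ => β n ⌊(2 : ℝ) ^ n * x⌋₊ :=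
  (measurable_from_nat (f := β n)).comp (Nat.measurable_floor.comp (measurable_const_mul _))

lemma measurable_branchSum (β : ℕ → ℕ → ENNReal) (N n : ℕ) : Measurable (branchSum β N n) :=
  Finset.measurable_fun_sum _ fun i _ => measurable_branchTerm β (n + i)

lemma branchSum_succ (β : ℕ → ℕ → ENNReal) (N n : ℕ) (x : ℝ) :
    branchSum β (N + 1) n x = β n ⌊(2 : ℝ) ^ n * x⌋₊ + branchSum β N (n + 1) x := by
  unfold branchSum
  rw [Finset.sum_range_succ', add_comm]
  simp only [add_zero, add_assoc, add_comm 1]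

lemma branchSum_succ_of_mem (β : ℕ → ℕ → ENNReal) (N : ℕ) {n k : ℕ} {x : ℝ}
    (hx : x ∈ dyadicI n k) :
    branchSum β (N + 1) n x = β n k + branchSum β N (n + 1) x := by
  rw [branchSum_succ, (mem_dyadicI_iff.1 hx).2]

variable {μ : Measure ℝ}

lemma lintegral_branchSum (β : ℕ → ℕ → ENNReal) (N : ℕ) : ∀ n k,
    ∫⁻ x in dyadicI n k, branchSum β N n x ∂μ =
      treeSum (fun n k => β n k * μ (dyadicI n k)) N n k := by
  induction N with
  | zero => intro n k; simp [branchSum, treeSum]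
  | succ N ih =>
    intro n k
    rw [setLIntegral_congr_fun (measurableSet_dyadicI n k)
      fun x hx => branchSum_succ_of_mem β N hx, lintegral_add_left measurable_const,
      setLIntegral_const, setLIntegral_dyadicI_split, ih, ih]
    rfl

lemma lintegral_branchSum_sq_le {β : ℕ → ℕ → ENNReal} {D : ENNReal}
    (hD : ∀ N n k, k < 2 ^ n →
      treeSum (fun n k => β n k * μ (dyadicI n k)) N n k ≤ D * μ (dyadicI n k)) (N : ℕ) :
    ∀ n k, k < 2 ^ n → ∫⁻ x in dyadicI n k, branchSum β N n x ^ 2 ∂μ ≤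
      2 * D * treeSum (fun n k => β n k * μ (dyadicI n k)) N n k := by
  induction N with
  | zero => intro n k _; simp [branchSum, treeSum]
  | succ N ih =>
    intro n k hk
    obtain ⟨hk1, hk2⟩ := child_lt hk
    have h1 : ∀ x ∈ dyadicI n k, branchSum β (N + 1) n x ^ 2 ≤
        2 * β n k * branchSum β (N + 1) n x + branchSum β N (n + 1) x ^ 2 := by
      intro x hx
      rw [branchSum_succ_of_mem β N hx]
      generalize branchSum β N (n + 1) x = y
      calc (β n k + y) ^ 2 ≤ (β n k + y) ^ 2 + β n k ^ 2 := le_self_add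
        _ = _ := by ring
    calc ∫⁻ x in dyadicI n k, branchSum β (N + 1) n x ^ 2 ∂μ
        ≤ ∫⁻ x in dyadicI n k,
            (2 * β n k * branchSum β (N + 1) n x + branchSum β N (n + 1) x ^ 2) ∂μ :=
          setLIntegral_mono' (measurableSet_dyadicI n k) h1
      _ = 2 * β n k * treeSum (fun n k => β n k * μ (dyadicI n k)) (N + 1) n k +
          (∫⁻ x in dyadicI (n + 1) (2 * k), branchSum β N (n + 1) x ^ 2 ∂μ +
            ∫⁻ x in dyadicI (n + 1) (2 * k + 1), branchSum β N (n + 1) x ^ 2 ∂μ) := by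
          rw [lintegral_add_left ((measurable_branchSum β _ _).const_mul _),
            lintegral_const_mul _ (measurable_branchSum β _ _), lintegral_branchSum,
            setLIntegral_dyadicI_split]
      _ ≤ 2 * β n k * (D * μ (dyadicI n k)) +
          (2 * D * treeSum (fun n k => β n k * μ (dyadicI n k)) N (n + 1) (2 * k) +
          2 * D * treeSum (fun n k => β n k * μ (dyadicI n k)) N (n + 1) (2 * k + 1)) := by
          gcongr
          · exact hD _ _ _ hk
          · exact ih _ _ hk1
          · exact ih _ _ hk2
      _ = _ := by simp only [treeSum]; ring

/-- The weak-type bound for the dyadic maximal function along finitely many generations. -/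
lemma measure_exists_gt_le {u h : ℕ → ℕ → ℝ} (hh0 : ∀ n k, k < 2 ^ n → 0 ≤ h n k)
    (hh : ∀ n k, k < 2 ^ n → h n k = h (n + 1) (2 * k) + h (n + 1) (2 * k + 1))
    (hu : ∀ n k, k < 2 ^ n → 1 < u n k → μ (dyadicI n k) ≤ ENNReal.ofReal (h n k)) (N : ℕ) :
    ∀ n k, k < 2 ^ n →
      μ {x | x ∈ dyadicI n k ∧ ∃ i < N, 1 < u (n + i) ⌊(2 : ℝ) ^ (n + i) * x⌋₊} ≤
        ENNReal.ofReal (h n k) := by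
  induction N with
  | zero => intro n k _; simp
  | succ N ih =>
    intro n k hk
    obtain ⟨hk1, hk2⟩ := child_lt hk
    by_cases h1 : 1 < u n k
    · exact (measure_mono fun x hx => hx.1).trans (hu n k hk h1)
    · rw [hh n k hk, ENNReal.ofReal_add (hh0 _ _ hk1) (hh0 _ _ hk2)]
      refine (measure_mono ?_).trans
        ((measure_union_le _ _).trans (add_le_add (ih _ _ hk1) (ih _ _ hk2)))
      rintro x ⟨hx, i, hi, hxi⟩
      have hi0 : i ≠ 0 := by
        rintro rfl
        rw [add_zero, (mem_dyadicI_iff.1 hx).2] at hxi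
        exact h1 hxi
      obtain ⟨j, rfl⟩ := Nat.exists_eq_succ_of_ne_zero hi0
      have hj : j < N := by omega
      rw [Nat.succ_eq_add_one, add_comm j, ← add_assoc] at hxi
      rw [dyadicI_eq_union] at hx
      exact hx.imp (fun hx => ⟨hx, j, hj, hxi⟩) fun hx => ⟨hx, j, hj, hxi⟩

lemma sqFnSq_eq_tsum (φ : ℝ → ℝ) {x : ℝ} (hx : 0 ≤ x) :
    sqFnSq φ x = ∑' n, ENNReal.ofReal (haarDiff φ n ⌊(2 : ℝ) ^ n * x⌋₊ ^ 2) := by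
  unfold sqFnSq
  rw [ENNReal.tsum_prod']
  congr 1; funext n
  rw [tsum_eq_single ⌊(2 : ℝ) ^ n * x⌋₊]
  · exact Set.indicator_of_mem (mem_dyadicI_iff.2 ⟨hx, rfl⟩) _
  · intro k hk
    exact Set.indicator_of_notMem (fun h => hk (mem_dyadicI_iff.1 h).2.symm) _

lemma exists_lt_branchSum (φ : ℝ → ℝ) {x : ℝ} (hx : 0 ≤ x) {c : ENNReal} (h : c < sqFnSq φ x) :
    ∃ N, c < branchSum (fun n k => ENNReal.ofReal (haarDiff φ n k ^ 2)) N 0 x := by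
  rw [sqFnSq_eq_tsum φ hx, ENNReal.tsum_eq_iSup_nat, lt_iSup_iff] at h
  simpa [branchSum] using h

lemma branchSum_mono_left (β : ℕ → ℕ → ENNReal) (n : ℕ) (x : ℝ) :
    Monotone fun N => branchSum β N n x := fun _ _ h =>
  Finset.sum_le_sum_of_subset (Finset.range_mono h)

lemma ofReal_haarDiff_sq_le_tsum {φ : ℝ → ℝ} (hφ : IntegrableOn φ (Set.Ico (0 : ℝ) 1)) {n k : ℕ}
    (hk : k < 2 ^ n) (hu : avg (fun x => |φ x|) n k ≤ 1) :
    ENNReal.ofReal (haarDiff φ n k ^ 2) ≤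
      ∑' j : ℕ, ENNReal.ofReal (levelCoeff φ ((2 ^ j)⁻¹) n k) := by
  have hu0 : 0 ≤ avg (fun x => |φ x|) n k := (abs_nonneg _).trans (abs_avg_le φ n k)
  rcases hu0.eq_or_lt with h0 | h0
  · have h1 := avg_split hφ.abs hk
    have h2 := abs_avg_le φ (n + 1) (2 * k)
    have h3 := abs_avg_le φ (n + 1) (2 * k + 1)
    have h4 := abs_nonneg (avg φ (n + 1) (2 * k))
    have h5 := abs_nonneg (avg φ (n + 1) (2 * k + 1))
    have h6 : avg φ (n + 1) (2 * k) = 0 := abs_eq_zero.1 (by linarith)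
    have h7 : avg φ (n + 1) (2 * k + 1) = 0 := abs_eq_zero.1 (by linarith)
    simp [haarDiff, h6, h7]
  · obtain ⟨j, hj1, hj2⟩ := exists_nat_pow_near_of_lt_one h0 hu (y := (2 : ℝ)⁻¹)
      (by norm_num) (by norm_num)
    refine le_trans ?_ (ENNReal.le_tsum j)
    unfold levelCoeff
    rw [if_pos]
    rw [inv_pow] at hj1 hj2
    refine ⟨?_, hj2⟩
    rw [pow_succ] at hj1
    calc _ = _ := by field_simp
      _ < _ := hj1

lemma branchSum_haarDiff_le_tsum {φ : ℝ → ℝ} (hφ : IntegrableOn φ (Set.Ico (0 : ℝ) 1)) {N : ℕ}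
    {x : ℝ} (hx : x ∈ Set.Ico (0 : ℝ) 1)
    (hu : ∀ i < N, avg (fun x => |φ x|) i ⌊(2 : ℝ) ^ i * x⌋₊ ≤ 1) :
    branchSum (fun n k => ENNReal.ofReal (haarDiff φ n k ^ 2)) N 0 x ≤
      ∑' j : ℕ, branchSum (fun n k => ENNReal.ofReal (levelCoeff φ ((2 ^ j)⁻¹) n k)) N 0 x := by
  unfold branchSum
  rw [Summable.tsum_finsetSum fun _ _ => ENNReal.summable]
  refine Finset.sum_le_sum fun i hi => ?_
  rw [zero_add]
  exact ofReal_haarDiff_sq_le_tsum hφ (floor_lt_two_pow hx.1 hx.2 i) (hu i (Finset.mem_range.1 hi))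

end BranchSums

section WeakType

lemma le_inv_add_mul_sq (a : ENNReal) (m : ℕ) : a ≤ (2 ^ m)⁻¹ + 2 ^ m * a ^ 2 := by
  rcases le_total a (2 ^ m)⁻¹ with h | h
  · exact h.trans le_self_add
  · refine le_trans ?_ le_add_self
    calc a = 2 ^ m * ((2 ^ m)⁻¹ * a) := by
          rw [← mul_assoc, ENNReal.mul_inv_cancel (by positivity) (by finiteness), one_mul]
      _ ≤ 2 ^ m * (a * a) := by gcongr
      _ = _ := by rw [sq]

lemma half_le_of_one_lt_tsum {F : ℕ → ENNReal} (h : 1 < ∑' j, F j) (K : ℕ) :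
    2⁻¹ ≤ ∑ j ∈ Finset.range K, F j + ∑' i, 2 ^ (i + 2) * F (i + K) ^ 2 := by
  have h1 : ∑' j, F j ≤
      2⁻¹ + (∑ j ∈ Finset.range K, F j + ∑' i, 2 ^ (i + 2) * F (i + K) ^ 2) := by
    calc ∑' j, F j = ∑ j ∈ Finset.range K, F j + ∑' i, F (i + K) :=
          (ENNReal.summable.sum_add_tsum_nat_add').symm
      _ ≤ ∑ j ∈ Finset.range K, F j +
          ∑' i, ((2 ^ (i + 2))⁻¹ + 2 ^ (i + 2) * F (i + K) ^ 2) := by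
          gcongr with i
          exact le_inv_add_mul_sq _ _
      _ = _ := by
          rw [ENNReal.tsum_add]
          have : ∑' i : ℕ, ((2 : ENNReal) ^ (i + 2))⁻¹ = 2⁻¹ := by
            simp_rw [ENNReal.inv_pow, pow_add, ENNReal.tsum_mul_right, ENNReal.tsum_geometric]
            rw [ENNReal.one_sub_inv_two, inv_inv, sq, ← mul_assoc,
              ENNReal.mul_inv_cancel (by norm_num) (by norm_num), one_mul]
          rw [this]; ring
  by_contra! hlt
  have h2 := (h.trans_le h1).trans (ENNReal.add_lt_add_left (by norm_num) hlt)
  rw [ENNReal.inv_two_add_inv_two] at h2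
  exact lt_irrefl _ h2

lemma measure_one_lt_tsum_le {μ : Measure ℝ} {F : ℕ → ℝ → ENNReal} (hF : ∀ j, Measurable (F j))
    {B : ℝ} (hB : 0 ≤ B) (K : ℕ) (h1 : ∀ j, ∫⁻ x, F j x ∂μ ≤ ENNReal.ofReal B)
    (h2 : ∀ i, 2 ^ (i + 2) * ∫⁻ x, F (i + K) x ^ 2 ∂μ ≤ ENNReal.ofReal (720 * B * (1 / 2) ^ i)) :
    μ {x | 1 < ∑' j, F j x} ≤ ENNReal.ofReal (2 * (K * B + 1440 * B)) := by
  set H : ℝ → ENNReal := fun x =>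
    ∑ j ∈ Finset.range K, F j x + ∑' i, 2 ^ (i + 2) * F (i + K) x ^ 2 with hH
  have hS : Measurable fun x => ∑ j ∈ Finset.range K, F j x :=
    Finset.measurable_fun_sum _ fun j _ => hF j
  have hR : ∀ i, Measurable fun x => 2 ^ (i + 2) * F (i + K) x ^ 2 := fun i =>
    ((hF _).pow_const 2).const_mul _
  have hHm : Measurable H := hS.add (Measurable.tsum hR)
  have hint : ∫⁻ x, H x ∂μ ≤ ENNReal.ofReal (K * B + 1440 * B) := by
    rw [hH, lintegral_add_left hS, lintegral_finsetSum _ fun j _ => hF j,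
      lintegral_tsum fun i => (hR i).aemeasurable,
      ENNReal.ofReal_add (by positivity) (by positivity)]
    gcongr
    · calc _ ≤ ∑ j ∈ Finset.range K, ENNReal.ofReal B := Finset.sum_le_sum fun j _ => h1 j
        _ = _ := by
          rw [Finset.sum_const, Finset.card_range, nsmul_eq_mul,
            ENNReal.ofReal_mul (by positivity), ENNReal.ofReal_natCast]
    · calc _ ≤ ∑' i : ℕ, ENNReal.ofReal (720 * B * (1 / 2) ^ i) := by
            gcongr with i
            rw [lintegral_const_mul _ ((hF _).pow_const 2)]
            exact h2 i
        _ = _ := by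
          rw [← ENNReal.ofReal_tsum_of_nonneg (fun i => by positivity)
            (summable_geometric_two.mul_left _), tsum_mul_left, tsum_geometric_two]
          congr 1; ring
  calc μ {x | 1 < ∑' j, F j x} ≤ μ {x | 2⁻¹ ≤ H x} :=
        measure_mono fun x hx => half_le_of_one_lt_tsum hx K
    _ = 2 * (2⁻¹ * μ {x | 2⁻¹ ≤ H x}) := by
        rw [← mul_assoc, ENNReal.mul_inv_cancel (by norm_num) (by norm_num), one_mul]
    _ ≤ 2 * ∫⁻ x, H x ∂μ := by gcongr; exact mul_meas_ge_le_lintegral hHm _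
    _ ≤ 2 * ENNReal.ofReal (K * B + 1440 * B) := by gcongr
    _ = _ := by rw [ENNReal.ofReal_mul (by norm_num), ENNReal.ofReal_ofNat]

/-- The measure `w dx` on `[0,1)`. -/
def weightMeasure (w : ℝ → ℝ) : Measure ℝ :=
  (volume.restrict (Set.Ico (0 : ℝ) 1)).withDensity fun x => ENNReal.ofReal (w x)

variable {w φ : ℝ → ℝ} {P Q : ℝ}

lemma weightMeasure_apply_of_subset (w : ℝ → ℝ) {s : Set ℝ} (hs : s ⊆ Set.Ico (0 : ℝ) 1) :
    weightMeasure w s = ∫⁻ x in s, ENNReal.ofReal (w x) := by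
  rw [weightMeasure, withDensity_apply', Measure.restrict_restrict_of_subset hs]

lemma weightMeasure_dyadicI (hwpos : ∀ x ∈ Set.Ico (0 : ℝ) 1, 0 < w x)
    (hw : IntegrableOn w (Set.Ico (0 : ℝ) 1)) {n k : ℕ} (hk : k < 2 ^ n) :
    weightMeasure w (dyadicI n k) = ENNReal.ofReal (∫ x in dyadicI n k, w x) := by
  have hsub := dyadicI_subset_Ico hk
  rw [weightMeasure_apply_of_subset w hsub, ofReal_integral_eq_lintegral_ofReal (hw.mono_set hsub)]
  filter_upwards [ae_restrict_mem (measurableSet_dyadicI n k)] with x hx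
  exact (hwpos x (hsub hx)).le

lemma treeSum_ofReal_mul_weightMeasure (hwpos : ∀ x ∈ Set.Ico (0 : ℝ) 1, 0 < w x)
    (hw : IntegrableOn w (Set.Ico (0 : ℝ) 1)) {β : ℕ → ℕ → ℝ} (hβ : ∀ n k, 0 ≤ β n k) (N : ℕ) :
    ∀ n k, k < 2 ^ n →
      treeSum (fun n k => ENNReal.ofReal (β n k) * weightMeasure w (dyadicI n k)) N n k =
        ENNReal.ofReal (treeSum (fun n k => β n k * ∫ x in dyadicI n k, w x) N n k) := by
  induction N with
  | zero => intro n k _; simp [treeSum]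
  | succ N ih =>
    intro n k hk
    obtain ⟨hk1, hk2⟩ := child_lt hk
    have h0 : ∀ n k, k < 2 ^ n → 0 ≤ β n k * ∫ x in dyadicI n k, w x := fun n k hk =>
      mul_nonneg (hβ n k) (setIntegral_nonneg (measurableSet_dyadicI n k)
        fun x hx => (hwpos x (dyadicI_subset_Ico hk hx)).le)
    have h1 := treeSum_nonneg h0 N _ _ hk1
    have h2 := treeSum_nonneg h0 N _ _ hk2
    simp only [treeSum]
    rw [ih _ _ hk1, ih _ _ hk2, weightMeasure_dyadicI hwpos hw hk, ← ENNReal.ofReal_mul (hβ n k),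
      ← ENNReal.ofReal_add h1 h2, ← ENNReal.ofReal_add (h0 n k hk) (add_nonneg h1 h2)]

lemma exists_le_four_pow (hP : 1 ≤ P) : ∃ K : ℕ, P ≤ 4 ^ K ∧ (K : ℝ) ≤ 3 * Real.log (1 + P) := by
  have hlog : Real.log 2 ≤ Real.log (1 + P) := Real.log_le_log (by norm_num) (by linarith)
  have h2 := Real.log_two_gt_d9
  refine ⟨⌈Real.log (1 + P)⌉₊, ?_, ?_⟩
  · calc P ≤ 1 + P := by linarith
      _ = Real.exp (Real.log (1 + P)) := (Real.exp_log (by linarith)).symm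
      _ ≤ Real.exp (⌈Real.log (1 + P)⌉₊ * 1) := by
          rw [mul_one]; exact Real.exp_le_exp.2 (Nat.le_ceil _)
      _ = Real.exp 1 ^ ⌈Real.log (1 + P)⌉₊ := Real.exp_nat_mul _ _
      _ ≤ _ := by
          gcongr
          linarith [Real.exp_one_lt_d9]
  · have := Nat.ceil_lt_add_one (by linarith : 0 ≤ Real.log (1 + P))
    linarith

lemma weightMeasure_one_lt_branchSum_le (hwpos : ∀ x ∈ Set.Ico (0 : ℝ) 1, 0 < w x)
    (hw : IntegrableOn w (Set.Ico (0 : ℝ) 1))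
    (hσ : IntegrableOn (fun x => (w x)⁻¹) (Set.Ico (0 : ℝ) 1)) (hQ : 1 ≤ Q)
    (hA₂ : ∀ n k : ℕ, k < 2 ^ n → avg w n k * avg (fun x => (w x)⁻¹) n k ≤ Q) (hP : 1 ≤ P)
    (hFW : ∀ n k : ℕ, k < 2 ^ n →
      ∫⁻ x in dyadicI n k, dyMax (Set.indicator (dyadicI n k) w) x
        ≤ ENNReal.ofReal (P * ∫ x in dyadicI n k, w x))
    (hφ : IntegrableOn φ (Set.Ico (0 : ℝ) 1))
    (hφw : IntegrableOn (fun x => φ x ^ 2 * w x) (Set.Ico (0 : ℝ) 1)) (N : ℕ) :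
    weightMeasure w {x | x ∈ Set.Ico (0 : ℝ) 1 ∧
        1 < branchSum (fun n k => ENNReal.ofReal (haarDiff φ n k ^ 2)) N 0 x} ≤
      ENNReal.ofReal (2100000 * Q * Real.log (1 + P) *
        ∫ x in Set.Ico (0 : ℝ) 1, φ x ^ 2 * w x) := by
  set μ := weightMeasure w with hμ
  set X := ∫ x in Set.Ico (0 : ℝ) 1, φ x ^ 2 * w x with hX
  have hX0 : ∀ n k, k < 2 ^ n → 0 ≤ ∫ x in dyadicI n k, φ x ^ 2 * w x := fun n k hk =>
    setIntegral_nonneg (measurableSet_dyadicI n k) fun x hx =>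
      mul_nonneg (sq_nonneg _) (hwpos x (dyadicI_subset_Ico hk hx)).le
  have hXpos : 0 ≤ X := by simpa [dyadicI_zero_zero] using hX0 0 0 (by norm_num)
  have hQ0 : 0 < Q := by linarith
  obtain ⟨K, hK, hKlog⟩ := exists_le_four_pow hP
  set F : ℕ → ℝ → ENNReal := fun j =>
    branchSum (fun n k => ENNReal.ofReal (levelCoeff φ ((2 ^ j)⁻¹) n k)) N 0
  have hT : ∀ j, treeSum (fun n k => ENNReal.ofReal (levelCoeff φ ((2 ^ j)⁻¹) n k) *
      μ (dyadicI n k)) N 0 0 ≤ ENNReal.ofReal (360 * Q * X) := by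
    intro j
    rw [hμ, treeSum_ofReal_mul_weightMeasure hwpos hw (levelCoeff_nonneg φ _) N 0 0 (by norm_num),
      hX, ← dyadicI_zero_zero]
    exact ENNReal.ofReal_le_ofReal (treeSum_levelCoeff_mul_weight_le hwpos hσ hQ0 hA₂ hφ hφw
      (by positivity) N 0 0 (by norm_num))
  have hlevels : (μ.restrict (Set.Ico 0 1)) {x | 1 < ∑' j, F j x} ≤
      ENNReal.ofReal (2 * (K * (360 * Q * X) + 1440 * (360 * Q * X))) := by
    refine measure_one_lt_tsum_le (fun j => measurable_branchSum _ _ _) (by positivity) K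
      (fun j => ?_) fun i => ?_
    · rw [← dyadicI_zero_zero, lintegral_branchSum]
      exact hT j
    · have hsq := lintegral_branchSum_sq_le (μ := μ)
        (β := fun n k => ENNReal.ofReal (levelCoeff φ ((2 ^ (i + K))⁻¹) n k))
        (D := ENNReal.ofReal (90 * ((2 ^ (i + K))⁻¹) ^ 2 * P)) ?_ N 0 0 (by norm_num)
      · rw [← dyadicI_zero_zero]
        calc _ ≤ 2 ^ (i + 2) * (2 * ENNReal.ofReal (90 * ((2 ^ (i + K))⁻¹) ^ 2 * P) *
              ENNReal.ofReal (360 * Q * X)) := by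
              gcongr
              exact hsq.trans (by gcongr; exact hT _)
          _ = ENNReal.ofReal (2 ^ (i + 2) * (2 * (90 * ((2 ^ (i + K))⁻¹) ^ 2 * P) *
              (360 * Q * X))) := by
              rw [ENNReal.ofReal_mul (p := 2 ^ (i + 2)) (by positivity),
                ENNReal.ofReal_mul (p := 2 * _) (q := 360 * Q * X) (by positivity),
                ENNReal.ofReal_mul (p := 2) (by norm_num), ENNReal.ofReal_pow (by positivity),
                ENNReal.ofReal_ofNat]
          _ ≤ _ := by
              apply ENNReal.ofReal_le_ofReal
              have h4 : ((4 : ℝ) ^ K) = (2 ^ K) ^ 2 := by rw [← pow_mul, mul_comm, pow_mul]; norm_num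
              calc _ = 720 * (360 * Q * X) * (1 / 2) ^ i * (P * ((2 ^ K) ^ 2)⁻¹) := by
                    simp only [pow_add, one_div, inv_pow]; field_simp; ring
                _ ≤ 720 * (360 * Q * X) * (1 / 2) ^ i * ((2 ^ K) ^ 2 * ((2 ^ K) ^ 2)⁻¹) := by
                    rw [← h4]; gcongr
                _ = _ := by field_simp
      · intro N n k hk
        rw [hμ, treeSum_ofReal_mul_weightMeasure hwpos hw (levelCoeff_nonneg φ _) N n k hk,
          weightMeasure_dyadicI hwpos hw hk, ← ENNReal.ofReal_mul (by positivity)]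
        exact ENNReal.ofReal_le_ofReal (treeSum_levelCoeff_mul_weight_le_mul hwpos (by linarith)
          hFW hφ (by positivity) N n k hk)
  have hmax := measure_exists_gt_le (μ := μ) (u := avg fun x => |φ x|)
    (h := fun n k => Q * ∫ x in dyadicI n k, φ x ^ 2 * w x)
    (fun n k hk => mul_nonneg hQ0.le (hX0 n k hk))
    (fun n k hk => by rw [setIntegral_dyadicI_split hφw hk, mul_add]) ?_ N 0 0 (by norm_num)
  · rw [dyadicI_zero_zero] at hmax
    refine (measure_mono (t := {x | x ∈ Set.Ico (0 : ℝ) 1 ∧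
      ∃ i < N, 1 < avg (fun x => |φ x|) (0 + i) ⌊(2 : ℝ) ^ (0 + i) * x⌋₊} ∪
      {x | 1 < ∑' j, F j x} ∩ Set.Ico 0 1) ?_).trans
      ((measure_union_le _ _).trans ?_)
    · rintro x ⟨hx, hx1⟩
      by_cases h : ∃ i < N, 1 < avg (fun x => |φ x|) (0 + i) ⌊(2 : ℝ) ^ (0 + i) * x⌋₊
      · exact Or.inl ⟨hx, h⟩
      · refine Or.inr ⟨hx1.trans_le (branchSum_haarDiff_le_tsum hφ hx ?_), hx⟩
        push Not at h
        simpa using h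
    · rw [← Measure.restrict_apply' measurableSet_Ico]
      refine (add_le_add hmax hlevels).trans ?_
      rw [← ENNReal.ofReal_add (by positivity) (by positivity)]
      apply ENNReal.ofReal_le_ofReal
      have hlog : Real.log 2 ≤ Real.log (1 + P) := Real.log_le_log (by norm_num) (by linarith)
      have h2 := Real.log_two_gt_d9
      calc Q * X + 2 * (K * (360 * Q * X) + 1440 * (360 * Q * X))
          = (720 * K + 1036801) * (Q * X) := by ring
        _ ≤ (2100000 * Real.log (1 + P)) * (Q * X) := by gcongr; linarith
        _ = _ := by ring
  · intro n k hk hu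
    rw [hμ, weightMeasure_dyadicI hwpos hw hk]
    apply ENNReal.ofReal_le_ofReal
    have hs : 0 < avg (fun x => (w x)⁻¹) n k :=
      avg_pos_of_pos hσ (fun x hx => inv_pos.2 (hwpos x hx)) hk
    have h1 : avg w n k ≤ Q / avg (fun x => (w x)⁻¹) n k := (le_div_iff₀ hs).2 (hA₂ n k hk)
    calc ∫ x in dyadicI n k, w x = (2 ^ n)⁻¹ * avg w n k := by unfold avg; field_simp
      _ ≤ (2 ^ n)⁻¹ * (Q * 1 ^ 2 / avg (fun x => (w x)⁻¹) n k) := by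
          rw [one_pow, mul_one]; gcongr
      _ ≤ (2 ^ n)⁻¹ * (Q * avg (fun x => |φ x|) n k ^ 2 / avg (fun x => (w x)⁻¹) n k) := by gcongr
      _ = Q * ((2 ^ n)⁻¹ * (avg (fun x => |φ x|) n k ^ 2 / avg (fun x => (w x)⁻¹) n k)) := by ring
      _ ≤ _ := by
          gcongr
          exact avg_abs_sq_div_le hwpos hσ hφ hφw hk

end WeakType

/-- there is an absolute constant `C > 0` such that for every weight `w` on
`[0,1)` with `[w]_{A₂} ≤ Q` (`1 ≤ Q`) and Fujii–Wilson dyadic `A∞` characteristic at most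
`P` (`1 ≤ P`), and every `φ ∈ L²(w)`,
`w({x ∈ (0,1) : Sφ(x) > 1}) ≤ C Q log(1+P) ∫ φ² w`; consequently `S : L²(w) → L^{2,∞}(w)`
with norm at most `C' Q^{1/2} log^{1/2}(1+P)`.  The condition `Sφ(x) > 1` is written as
`1 < (Sφ(x))²`. -/
theorem weak_type_squareFunction_log :
    ∃ C : ℝ, 0 < C ∧
      ∀ w : ℝ → ℝ, Measurable w →
        (∀ x ∈ Set.Ico (0 : ℝ) 1, 0 < w x) →
        IntegrableOn w (Set.Ico (0 : ℝ) 1) →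
        IntegrableOn (fun x => (w x)⁻¹) (Set.Ico (0 : ℝ) 1) →
        ∀ Q : ℝ, 1 ≤ Q →
          (∀ n k : ℕ, k < 2 ^ n →
            avg w n k * avg (fun x => (w x)⁻¹) n k ≤ Q) →
        ∀ P : ℝ, 1 ≤ P →
          (∀ n k : ℕ, k < 2 ^ n →
            ∫⁻ x in dyadicI n k, dyMax (Set.indicator (dyadicI n k) w) x
              ≤ ENNReal.ofReal (P * ∫ x in dyadicI n k, w x)) →
        ∀ φ : ℝ → ℝ, Measurable φ →
          IntegrableOn (fun x => φ x ^ 2 * w x) (Set.Ico (0 : ℝ) 1) →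
          (∫ x in {x : ℝ | x ∈ Set.Ioo (0 : ℝ) 1 ∧ 1 < sqFnSq φ x}, w x)
            ≤ C * Q * Real.log (1 + P) * ∫ x in Set.Ico (0 : ℝ) 1, φ x ^ 2 * w x := by
  refine ⟨2100000, by norm_num, ?_⟩
  intro w hwm hwpos hw hσ Q hQ hA₂ P hP hFW φ hφm hφw
  have hφ := integrableOn_of_sq_mul_weight hwpos hσ hφm hφw
  set S := {x : ℝ | x ∈ Set.Ioo (0 : ℝ) 1 ∧ 1 < sqFnSq φ x}
  have hSsub : S ⊆ Set.Ico (0 : ℝ) 1 := fun x hx => Set.Ioo_subset_Ico_self hx.1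
  set E : ℕ → Set ℝ := fun N => {x | x ∈ Set.Ico (0 : ℝ) 1 ∧
    1 < branchSum (fun n k => ENNReal.ofReal (haarDiff φ n k ^ 2)) N 0 x}
  have hE : Monotone E := fun M N hMN x hx =>
    ⟨hx.1, hx.2.trans_le (branchSum_mono_left _ 0 x hMN)⟩
  have hSE : S ⊆ ⋃ N, E N := by
    intro x hx
    obtain ⟨N, hN⟩ := exists_lt_branchSum φ hx.1.1.le hx.2
    exact Set.mem_iUnion.2 ⟨N, hSsub hx, hN⟩
  have hS : weightMeasure w S ≤ ENNReal.ofReal (2100000 * Q * Real.log (1 + P) *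
      ∫ x in Set.Ico (0 : ℝ) 1, φ x ^ 2 * w x) := by
    refine (measure_mono hSE).trans ?_
    rw [hE.measure_iUnion]
    exact iSup_le fun N =>
      weightMeasure_one_lt_branchSum_le hwpos hw hσ hQ hA₂ hP hFW hφ hφw N
  have hnonneg : 0 ≤ ∫ x in Set.Ico (0 : ℝ) 1, φ x ^ 2 * w x :=
    setIntegral_nonneg measurableSet_Ico fun x hx => mul_nonneg (sq_nonneg _) (hwpos x hx).le
  have hlog : 0 ≤ Real.log (1 + P) := Real.log_nonneg (by linarith)
  rw [integral_eq_lintegral_of_nonneg_ae _ hwm.aestronglyMeasurable,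
    ← weightMeasure_apply_of_subset w hSsub]
  · exact ENNReal.toReal_le_of_le_ofReal (by positivity) hS
  · apply ae_restrict_of_ae_restrict_of_subset hSsub
    filter_upwards [ae_restrict_mem measurableSet_Ico] with x hx
    exact (hwpos x hx).le
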